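/- Let k be an algebraically closed field of characteristic 0 and let ω ∈ k be a primitive cube root of unity. Consider the quadratic form q = ω·XY + ω·XZ + YZ over k. Then: (i) q is nondegenerate; (ii) among the twelve points of the dual Hesse configuration, q vanishes exactly at the five points m, n, p, P₁, a; (iii) the map φ : ℙ¹(k) → ℙ²(k), (u:v) ↦ (ωu² + uv : ωuv + v² : −ωuv), is well defined and is a bijection from ℙ¹(k) onto the zero locus of q in ℙ²(k); (iv) φ(1:0) = m, φ(0:1) = p, φ(1:1) = a, φ(1:ω²) = P₁, and φ(1:−ω) = n. -/

import Mathlib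

/-!
STATEMENT 9: Over an algebraically closed field `k` of characteristic 0 with `ω` a primitive cube
root of unity, the conic `q = ωXY + ωXZ + YZ` is nondegenerate, vanishes among the twelve points
of the dual Hesse configuration exactly at `m, n, p, P₁, a`, and the map
`φ : (u:v) ↦ (ωu² + uv : ωuv + v² : −ωuv)` is a well-defined bijection of `ℙ¹(k)` onto the zero
locus of `q` in `ℙ²(k)`, with `φ(1:0) = m`, `φ(0:1) = p`, `φ(1:1) = a`, `φ(1:ω²) = P₁`,
`φ(1:−ω) = n`.  (Projective points are represented by nonzero vectors, and `projEq x y` expresses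
that `x` and `y` define the same projective point.)
Indices: m=0, n=1, p=2, a=3, b=4, c=5, P₁=6, P₂=7, P₃=8, α=9, β=10, γ=11.
-/

open MvPolynomial

/-- The twelve points of the dual Hesse configuration, as vectors in `k³`. -/
def dualHessePts (k : Type*) [Field k] (ω : k) : Fin 12 → (Fin 3 → k) :=
  ![![1, 0, 0], ![0, 0, 1], ![0, 1, 0],
    ![ω, ω, 1], ![1, ω, 1], ![ω ^ 2, ω, 1],
    ![1, ω ^ 2, 1], ![ω ^ 2, ω ^ 2, 1], ![ω, ω ^ 2, 1],
    ![ω, 1, 1], ![ω ^ 2, 1, 1], ![1, 1, 1]]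

/-- The conic through `m, n, p, P₁, a`. -/
noncomputable def hesseConic (k : Type*) [Field k] (ω : k) : MvPolynomial (Fin 3) k :=
  C ω * (X 0 * X 1) + C ω * (X 0 * X 2) + X 1 * X 2

/-- The symmetric matrix associated to a quadratic form `q` in three variables:
`A i j = (1/2)·∂i∂j q`. -/
noncomputable def assocMatrix {k : Type*} [Field k] (q : MvPolynomial (Fin 3) k) :
    Matrix (Fin 3) (Fin 3) k :=
  fun i j => (2 : k)⁻¹ * eval (fun _ => 0) (pderiv i (pderiv j q))

/-- Two nonzero vectors define the same projective point. -/
def projEq {k : Type*} [Field k] {n : ℕ} (x y : Fin n → k) : Prop :=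
  ∃ c : k, c ≠ 0 ∧ y = c • x

/-- The parametrization `(u, v) ↦ (ωu² + uv, ωuv + v², −ωuv)` of the conic. -/
def hesseVec (k : Type*) [Field k] (ω : k) (u v : k) : Fin 3 → k :=
  ![ω * u ^ 2 + u * v, ω * u * v + v ^ 2, -(ω * u * v)]

section HesseConic

variable {k : Type*} [Field k] {ω : k}

lemma eval_hesseConic (x : Fin 3 → k) :
    eval x (hesseConic k ω) = ω * (x 0 * x 1) + ω * (x 0 * x 2) + x 1 * x 2 := by
  simp [hesseConic]

lemma projEq_fin_two {u v u' v' c : k} (hc : c ≠ 0) (hu : u' = c * u) (hv : v' = c * v) :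
    projEq (![u, v] : Fin 2 → k) ![u', v'] :=
  ⟨c, hc, by simp [hu, hv]⟩

lemma projEq_fin_three {x y : Fin 3 → k} {c : k} (hc : c ≠ 0) (h0 : y 0 = c * x 0)
    (h1 : y 1 = c * x 1) (h2 : y 2 = c * x 2) : projEq x y :=
  ⟨c, hc, by ext i; fin_cases i <;> assumption⟩

lemma assocMatrix_hesseConic :
    assocMatrix (hesseConic k ω) = (2 : k)⁻¹ • !![0, ω, ω; ω, 0, 1; ω, 1, 0] := by
  ext i j
  fin_cases i <;> fin_cases j <;> simp [assocMatrix, hesseConic, pderiv_X]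

lemma hesseVec_ne_zero (h0 : ω ≠ 0) {u v : k} (h : ¬(u = 0 ∧ v = 0)) :
    hesseVec k ω u v ≠ 0 := by
  intro hz
  have hx := congrFun hz 0
  have hy := congrFun hz 1
  have hxy := congrFun hz 2
  simp only [hesseVec, Matrix.cons_val, Pi.zero_apply] at hx hy hxy
  have huv : u * v = 0 := by grind
  exact h ⟨by grind, by grind⟩

lemma projEq_of_projEq_hesseVec {u v u' v' : k} (h : ¬(u = 0 ∧ v = 0))
    (h' : ¬(u' = 0 ∧ v' = 0)) (hp : projEq (hesseVec k ω u v) (hesseVec k ω u' v')) :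
    projEq (![u, v] : Fin 2 → k) ![u', v'] := by
  obtain ⟨c, hc, hp⟩ := hp
  have hx := congrFun hp 0
  have hy := congrFun hp 1
  simp only [hesseVec, Matrix.cons_val, Pi.smul_apply, smul_eq_mul] at hx hy
  replace hx : u' * (ω * u' + v') = c * (u * (ω * u + v)) := by linear_combination hx
  replace hy : v' * (ω * u' + v') = c * (v * (ω * u + v)) := by linear_combination hy
  by_cases hL : ω * u + v = 0
  · have hL' : ω * u' + v' = 0 := by
      by_contra hL'
      simp only [hL, mul_zero, mul_eq_zero, hL', or_false] at hx hy
      exact h' ⟨hx, hy⟩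
    have hu : u ≠ 0 := by
      rintro rfl
      exact h ⟨rfl, by simpa using hL⟩
    have hu' : u' ≠ 0 := by
      rintro rfl
      exact h' ⟨rfl, by simpa using hL'⟩
    refine projEq_fin_two (div_ne_zero hu' hu) (by field_simp) ?_
    field_simp
    linear_combination u * hL' - u' * hL
  · have hL' : ω * u' + v' ≠ 0 := by
      intro hL'
      rw [hL', mul_zero, zero_eq_mul] at hx hy
      exact h ⟨((mul_eq_zero.mp (hx.resolve_left hc)).resolve_right hL),
        ((mul_eq_zero.mp (hy.resolve_left hc)).resolve_right hL)⟩
    refine projEq_fin_two (div_ne_zero (mul_ne_zero hc hL) hL') ?_ ?_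
    · rw [div_mul_eq_mul_div, eq_div_iff hL']
      linear_combination hx
    · rw [div_mul_eq_mul_div, eq_div_iff hL']
      linear_combination hy

lemma exists_projEq_hesseVec (h0 : ω ≠ 0) {x : Fin 3 → k} (hx : x ≠ 0)
    (hq : eval x (hesseConic k ω) = 0) :
    ∃ u v : k, ¬(u = 0 ∧ v = 0) ∧ projEq (hesseVec k ω u v) x := by
  rw [eval_hesseConic] at hq
  by_cases h : x 0 = 0 ∧ x 1 = 0
  · have hz : x 2 ≠ 0 := by
      intro hz
      apply hx
      ext i
      fin_cases i
      exacts [h.1, h.2, hz]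
    refine ⟨1, -ω, by simp, projEq_fin_three (c := x 2 / ω ^ 2) (by positivity) ?_ ?_ ?_⟩
    · simp [hesseVec, h.1]
    · simp only [hesseVec, Matrix.cons_val, h.2]
      ring
    · simp only [hesseVec, Matrix.cons_val]
      field_simp
  · have hL : ω * x 0 + x 1 ≠ 0 := by
      intro hL
      have hxy : x 0 * x 1 = 0 := by
        apply (mul_eq_zero.mp _).resolve_left h0
        linear_combination hq - x 2 * hL
      exact h (by grind)
    refine ⟨x 0, x 1, h, projEq_fin_three (inv_ne_zero hL) ?_ ?_ ?_⟩ <;>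
      rw [eq_inv_mul_iff_mul_eq₀ hL] <;> simp only [hesseVec, Matrix.cons_val]
    · ring
    · ring
    · linear_combination hq

end HesseConic

theorem dualHesse_conic_parametrization
    (k : Type*) [Field k] [IsAlgClosed k] [CharZero k] (ω : k)
    (hω1 : ω ≠ 1) (hω : ω ^ 2 + ω + 1 = 0) :
    -- (i) `q` is nondegenerate
    (assocMatrix (hesseConic k ω)).det ≠ 0 ∧
    -- (ii) among the twelve points, `q` vanishes exactly at `m, n, p, P₁, a`
    (∀ t : Fin 12,
      eval (dualHessePts k ω t) (hesseConic k ω) = 0 ↔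
        t ∈ ({0, 1, 2, 6, 3} : Finset (Fin 12))) ∧
    -- (iii) `φ` is well defined: nonzero pairs go to nonzero vectors, compatibly with scaling …
    (∀ u v : k, ¬(u = 0 ∧ v = 0) → hesseVec k ω u v ≠ 0) ∧
    (∀ c u v : k, hesseVec k ω (c * u) (c * v) = c ^ 2 • hesseVec k ω u v) ∧
    -- … its image lies on the conic, …
    (∀ u v : k, eval (hesseVec k ω u v) (hesseConic k ω) = 0) ∧
    -- … it is injective on `ℙ¹(k)`, …
    (∀ u v u' v' : k, ¬(u = 0 ∧ v = 0) → ¬(u' = 0 ∧ v' = 0) →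
      projEq (hesseVec k ω u v) (hesseVec k ω u' v') →
      projEq (![u, v] : Fin 2 → k) ![u', v']) ∧
    -- … and surjective onto the zero locus of `q` in `ℙ²(k)`
    (∀ Q : Projectivization k (Fin 3 → k), eval Q.rep (hesseConic k ω) = 0 →
      ∃ u v : k, ¬(u = 0 ∧ v = 0) ∧ projEq (hesseVec k ω u v) Q.rep) ∧
    -- (iv) special values of `φ`
    projEq (hesseVec k ω 1 0) (dualHessePts k ω 0) ∧
    projEq (hesseVec k ω 0 1) (dualHessePts k ω 2) ∧
    projEq (hesseVec k ω 1 1) (dualHessePts k ω 3) ∧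
    projEq (hesseVec k ω 1 (ω ^ 2)) (dualHessePts k ω 6) ∧
    projEq (hesseVec k ω 1 (-ω)) (dualHessePts k ω 1) := by
  have h0 : ω ≠ 0 := by
    rintro rfl
    simp at hω
  refine ⟨?_, ?_, fun u v => hesseVec_ne_zero h0, ?_, ?_,
    fun u v u' v' => projEq_of_projEq_hesseVec,
    fun Q => exists_projEq_hesseVec h0 Q.rep_nonzero, ?_, ?_, ?_, ?_, ?_⟩
  · rw [assocMatrix_hesseConic, Matrix.det_smul, Matrix.det_fin_three]
    simp [h0, ← two_mul]
  · intro t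
    rw [eval_hesseConic]
    fin_cases t <;> simp [dualHessePts] <;> grind
  · intro c u v
    ext i
    fin_cases i <;> simp [hesseVec] <;> ring
  · intro u v
    rw [eval_hesseConic]
    simp only [hesseVec, Matrix.cons_val]
    ring
  · apply projEq_fin_three (inv_ne_zero h0) <;> simp [hesseVec, dualHessePts, h0]
  · apply projEq_fin_three one_ne_zero <;> simp [hesseVec, dualHessePts]
  · apply projEq_fin_three (c := -ω ^ 2) (by simp [h0]) <;>
      simp [hesseVec, dualHessePts] <;> grind
  · apply projEq_fin_three (c := -1) (by simp) <;>
      simp [hesseVec, dualHessePts] <;> grind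
  · apply projEq_fin_three h0 <;> simp [hesseVec, dualHessePts] <;> grind
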